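/- arXiv:1101.5001 — 2 statements merged into one kernel-verified Lean document; each statement's English description precedes it below -/
import Mathlib

section
/- Let $A$, $B$, $C$ be finite sets in a commutative group with $A$, $B$ non-empty, and let $h$ be a positive integer. Let $\beta$ be the unique positive real satisfying $\prod_{r=0}^{h-1}(\beta + r) = h! \cdot |hB|$. Then $|(A + hB) \setminus (C + (h-1)B)| \le \left(1 + \frac{h}{\beta}\right) \frac{e\, |(A+B) \setminus C| \cdot |hB|^{1 - 1/h}}{h}$ (real power $|hB|^{1-1/h}$). -/
open Pointwise

/-- `iterSum B k` is the `k`-fold iterated sumset `B + ⋯ + B` (`k` times),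
with the convention `iterSum B 0 = {0}`. -/
def iterSum {G : Type*} [AddCommGroup G] [DecidableEq G] (B : Finset G) : ℕ → Finset G
  | 0 => {0}
  | k + 1 => iterSum B k + B

/-- The `k`-fold sumset of `S` consists of sums of `k`-element multisets over `S`. -/
theorem card_iterSum_le_multichoose {G : Type*} [AddCommGroup G] [DecidableEq G] (S : Finset G)
    (k : ℕ) : (iterSum S k).card ≤ S.card.multichoose k := by
  have hsub : iterSum S k ⊆ (Finset.univ : Finset (Sym S k)).image
      (fun m => (m.1.map Subtype.val).sum) := by
    induction k with
    | zero =>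
      intro x hx
      refine Finset.mem_image.2 ⟨Sym.nil, Finset.mem_univ _, ?_⟩
      exact (Finset.mem_singleton.1 hx).symm
    | succ k ih =>
      intro x hx
      obtain ⟨y, hy, b, hb, rfl⟩ := Finset.mem_add.1 hx
      obtain ⟨m, -, rfl⟩ := Finset.mem_image.1 (ih hy)
      refine Finset.mem_image.2 ⟨(⟨b, hb⟩ : S) ::ₛ m, Finset.mem_univ _, ?_⟩
      change (Multiset.map Subtype.val ((⟨b, hb⟩ : S) ::ₘ m.1)).sum = _
      rw [Multiset.map_cons, Multiset.sum_cons, add_comm]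
  refine (Finset.card_le_card hsub).trans (Finset.card_image_le.trans ?_)
  rw [Finset.card_univ, Sym.card_sym_eq_multichoose, Fintype.card_coe]

theorem factorial_mul_card_iterSum_le {G : Type*} [AddCommGroup G] [DecidableEq G]
    (S : Finset G) (k : ℕ) :
    (k.factorial : ℝ) * ((iterSum S k).card : ℝ) ≤ ∏ r ∈ Finset.range k, ((S.card : ℝ) + r) := by
  have h₁ : ∏ r ∈ Finset.range k, ((S.card : ℝ) + r) = (S.card.ascFactorial k : ℝ) := by
    rw [Nat.ascFactorial_eq_prod_range]
    push_cast
    rfl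
  have h₂ : k.factorial * S.card.multichoose k = S.card.ascFactorial k := by
    rw [Nat.multichoose_eq]
    exact (Nat.ascFactorial_eq_factorial_mul_choose' _ _).symm
  rw [h₁, ← h₂]
  exact_mod_cast Nat.mul_le_mul_left _ (card_iterSum_le_multichoose S k)

theorem iterSum_mono {G : Type*} [AddCommGroup G] [DecidableEq G] {S T : Finset G} (h : S ⊆ T)
    (k : ℕ) : iterSum S k ⊆ iterSum T k := by
  induction k with
  | zero => exact subset_rfl
  | succ k ih => exact Finset.add_subset_add ih h

/-- An element of `(k+1)B` outside `(k+1)S` has a representation with a summand outside `S`. -/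
theorem mem_iterSum_or_exists {G : Type*} [AddCommGroup G] [DecidableEq G] {B : Finset G}
    (S : Finset G) (k : ℕ) {x : G} (hx : x ∈ iterSum B (k + 1)) :
    x ∈ iterSum S (k + 1) ∨ ∃ y ∈ iterSum B k, ∃ b ∈ B, b ∉ S ∧ y + b = x := by
  induction k generalizing x with
  | zero =>
    obtain ⟨y, hy, b, hb, rfl⟩ := Finset.mem_add.1 hx
    by_cases hbS : b ∈ S
    · exact Or.inl (Finset.add_mem_add hy hbS)
    · exact Or.inr ⟨y, hy, b, hb, hbS, rfl⟩
  | succ k ih =>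
    obtain ⟨y, hy, b, hb, rfl⟩ := Finset.mem_add.1 hx
    by_cases hbS : b ∈ S
    · rcases ih hy with hyS | ⟨z, hz, c, hc, hcS, rfl⟩
      · exact Or.inl (Finset.add_mem_add hyS hbS)
      · exact Or.inr ⟨z + b, Finset.add_mem_add hz hb, c, hc, hcS, add_right_comm _ _ _⟩
    · exact Or.inr ⟨y, hy, b, hb, hbS, rfl⟩

/-- A subset `S` of `B` has `|hS| / |S|` at most `|hB| / β`. -/
theorem card_iterSum_mul_le {G : Type*} [AddCommGroup G] [DecidableEq G] {B S : Finset G}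
    (hS : S ⊆ B) (k : ℕ) {β : ℝ} (hβpos : 0 < β)
    (hβ : ∏ r ∈ Finset.range (k + 1), (β + r) =
      ((k + 1).factorial : ℝ) * ((iterSum B (k + 1)).card : ℝ)) :
    ((iterSum S (k + 1)).card : ℝ) * β ≤ (S.card : ℝ) * ((iterSum B (k + 1)).card : ℝ) := by
  rcases le_total β S.card with h | h
  · have h₁ : ((iterSum S (k + 1)).card : ℝ) ≤ ((iterSum B (k + 1)).card : ℝ) := by
      exact_mod_cast Finset.card_le_card (iterSum_mono hS _)
    rw [mul_comm]
    gcongr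
  · have hf : (0 : ℝ) < ((k + 1).factorial : ℝ) := by positivity
    refine le_of_mul_le_mul_left ?_ hf
    have h₁ := factorial_mul_card_iterSum_le S (k + 1)
    have h₂ : ∏ r ∈ Finset.range k, ((S.card : ℝ) + (r + 1 : ℕ)) ≤
        ∏ r ∈ Finset.range k, (β + (r + 1 : ℕ)) := by
      gcongr
    rw [Finset.prod_range_succ'] at h₁ hβ
    calc ((k + 1).factorial : ℝ) * (((iterSum S (k + 1)).card : ℝ) * β)
        = ((k + 1).factorial * ((iterSum S (k + 1)).card : ℝ)) * β := by ring
      _ ≤ ((∏ r ∈ Finset.range k, ((S.card : ℝ) + (r + 1 : ℕ))) * (S.card + (0 : ℕ))) * β := by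
        gcongr
      _ ≤ ((∏ r ∈ Finset.range k, (β + (r + 1 : ℕ))) * (S.card + (0 : ℕ))) * β := by
        gcongr
      _ = S.card * ((∏ r ∈ Finset.range k, (β + (r + 1 : ℕ))) * (β + (0 : ℕ))) := by
        push_cast; ring
      _ = _ := by rw [hβ]; ring

/-- The growth of restricted sumsets is bounded by `|hB| / β`. -/
theorem card_restricted_sumset_mul_le {G : Type*} [AddCommGroup G] [DecidableEq G]
    (A B C : Finset G) (k : ℕ) {β : ℝ} (hβpos : 0 < β)
    (hβ : ∏ r ∈ Finset.range (k + 1), (β + r) =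
      ((k + 1).factorial : ℝ) * ((iterSum B (k + 1)).card : ℝ)) :
    (((A + iterSum B (k + 1)) \ (C + iterSum B k)).card : ℝ) * β ≤
      (((A + B) \ C).card : ℝ) * ((iterSum B (k + 1)).card : ℝ) := by
  induction A using Finset.induction_on with
  | empty => simp
  | insert a A _ ih =>
    set S := B.filter (fun b => a + b ∉ C ∧ a + b ∉ A + B) with hSdef
    have h₁ : (insert a A + iterSum B (k + 1)) \ (C + iterSum B k) ⊆
        ((A + iterSum B (k + 1)) \ (C + iterSum B k)) ∪ (iterSum S (k + 1)).image (a + ·) := by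
      intro x hx
      obtain ⟨hx, hxC⟩ := Finset.mem_sdiff.1 hx
      obtain ⟨a', ha', s, hs, rfl⟩ := Finset.mem_add.1 hx
      rcases Finset.mem_insert.1 ha' with rfl | ha'
      · rcases mem_iterSum_or_exists S k hs with hsS | ⟨y, hy, b, hb, hbS, rfl⟩
        · exact Finset.mem_union_right _ (Finset.mem_image_of_mem _ hsS)
        · have e : a' + (y + b) = a' + b + y := by abel
          by_cases hC : a' + b ∈ C
          · exact absurd (e ▸ Finset.add_mem_add hC hy) hxC
          · have hAB : a' + b ∈ A + B := by
              by_contra hAB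
              exact hbS (Finset.mem_filter.2 ⟨hb, hC, hAB⟩)
            obtain ⟨c, hc, d, hd, hcd⟩ := Finset.mem_add.1 hAB
            refine Finset.mem_union_left _ (Finset.mem_sdiff.2 ⟨?_, hxC⟩)
            have e' : a' + (y + b) = c + (y + d) := by rw [e, ← hcd]; abel
            rw [e']
            exact Finset.add_mem_add hc (Finset.add_mem_add hy hd)
      · exact Finset.mem_union_left _
          (Finset.mem_sdiff.2 ⟨Finset.add_mem_add ha' hs, hxC⟩)
    have h₂ : ((A + B) \ C) ∪ S.image (a + ·) ⊆ (insert a A + B) \ C := by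
      intro x hx
      rcases Finset.mem_union.1 hx with hx | hx
      · obtain ⟨hx, hxC⟩ := Finset.mem_sdiff.1 hx
        exact Finset.mem_sdiff.2
          ⟨Finset.add_subset_add_right (Finset.subset_insert a A) hx, hxC⟩
      · obtain ⟨b, hb, rfl⟩ := Finset.mem_image.1 hx
        obtain ⟨hb, hC, -⟩ := Finset.mem_filter.1 hb
        exact Finset.mem_sdiff.2 ⟨Finset.add_mem_add (Finset.mem_insert_self a A) hb, hC⟩
    have hdisj : Disjoint ((A + B) \ C) (S.image (a + ·)) := by
      refine Finset.disjoint_left.2 fun x hx hxS => ?_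
      obtain ⟨b, hb, rfl⟩ := Finset.mem_image.1 hxS
      exact (Finset.mem_filter.1 hb).2.2 (Finset.mem_sdiff.1 hx).1
    have h₃ : ((A + B) \ C).card + S.card ≤ ((insert a A + B) \ C).card := by
      rw [← Finset.card_image_of_injective S (add_right_injective a),
        ← Finset.card_union_of_disjoint hdisj]
      exact Finset.card_le_card h₂
    have h₄ : ((insert a A + iterSum B (k + 1)) \ (C + iterSum B k)).card ≤
        ((A + iterSum B (k + 1)) \ (C + iterSum B k)).card + (iterSum S (k + 1)).card :=
      (Finset.card_le_card h₁).trans ((Finset.card_union_le _ _).trans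
        (Nat.add_le_add_left Finset.card_image_le _))
    have h₅ := card_iterSum_mul_le (Finset.filter_subset _ B : S ⊆ B) k hβpos hβ
    have h₃' : (((A + B) \ C).card : ℝ) + S.card ≤ ((insert a A + B) \ C).card := by
      exact_mod_cast h₃
    have h₄' : (((insert a A + iterSum B (k + 1)) \ (C + iterSum B k)).card : ℝ) ≤
        ((A + iterSum B (k + 1)) \ (C + iterSum B k)).card + (iterSum S (k + 1)).card := by
      exact_mod_cast h₄
    calc _ ≤ ((((A + iterSum B (k + 1)) \ (C + iterSum B k)).card : ℝ) +
          (iterSum S (k + 1)).card) * β := by gcongr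
      _ ≤ ((((A + B) \ C).card : ℝ) + S.card) * ((iterSum B (k + 1)).card : ℝ) := by
        rw [add_mul, add_mul]
        exact add_le_add ih h₅
      _ ≤ _ := by gcongr

/-- A real `N` with `h! N = β (β + 1) ⋯ (β + h - 1)` satisfies `N ≤ (e (β + h) / h) ^ h`. -/
theorem le_exp_mul_div_pow_of_prod_eq {h : ℕ} (hh : 0 < h) {β N : ℝ} (hβpos : 0 < β)
    (hβ : ∏ r ∈ Finset.range h, (β + r) = (Nat.factorial h : ℝ) * N) :
    N ≤ (Real.exp 1 * (β + h) / h) ^ h := by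
  have hf : (0 : ℝ) < (h.factorial : ℝ) := by positivity
  have hh' : (0 : ℝ) < h := by exact_mod_cast hh
  have h₁ : ∏ r ∈ Finset.range h, (β + r) ≤ (β + h) ^ h := by
    calc ∏ r ∈ Finset.range h, (β + r) ≤ ∏ _r ∈ Finset.range h, (β + (h : ℝ)) := by
          refine Finset.prod_le_prod (fun r _ => by positivity) fun r hr => ?_
          have : (r : ℝ) ≤ h := by exact_mod_cast (Finset.mem_range.1 hr).le
          linarith
      _ = _ := by simp
  have h₂ : (h : ℝ) ^ h / h.factorial ≤ Real.exp 1 ^ h := by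
    rw [← Real.exp_nat_mul, mul_one]
    exact Real.pow_div_factorial_le_exp _ hh'.le h
  rw [div_le_iff₀ hf] at h₂
  refine le_of_mul_le_mul_left ?_ hf
  rw [← hβ, div_pow, mul_pow]
  refine h₁.trans ?_
  rw [← mul_div_assoc, le_div_iff₀ (by positivity)]
  calc (β + h) ^ h * (h : ℝ) ^ h ≤ (β + h) ^ h * (Real.exp 1 ^ h * h.factorial) := by gcongr
    _ = _ := by ring

/-- Growth of restricted addition graphs: with `β` the pseudo-cardinality of `B`,
`|(A + hB) \ (C + (h-1)B)| ≤ (1 + h/β) · e · |(A+B) \ C| · |hB|^(1-1/h) / h`. -/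
theorem stmt_12 {G : Type*} [AddCommGroup G] [DecidableEq G]
    (A B C : Finset G) (hA : A.Nonempty) (hB : B.Nonempty)
    (h : ℕ) (hh : 0 < h) (β : ℝ) (hβpos : 0 < β)
    (hβ : ∏ r ∈ Finset.range h, (β + r) = (Nat.factorial h : ℝ) * ((iterSum B h).card : ℝ)) :
    (((A + iterSum B h) \ (C + iterSum B (h - 1))).card : ℝ) ≤
      (1 + (h : ℝ) / β) * (Real.exp 1 * (((A + B) \ C).card : ℝ) *
        ((iterSum B h).card : ℝ) ^ (1 - 1 / (h : ℝ))) / h := by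
  have hh' : (0 : ℝ) < h := by exact_mod_cast hh
  have hfact : (0 : ℝ) < (h.factorial : ℝ) := by positivity
  have hmain : (((A + iterSum B h) \ (C + iterSum B (h - 1))).card : ℝ) * β ≤
      (((A + B) \ C).card : ℝ) * ((iterSum B h).card : ℝ) := by
    obtain ⟨k, rfl⟩ := Nat.exists_eq_add_of_lt hh
    simp only [zero_add, Nat.add_sub_cancel] at hβ ⊢
    exact card_restricted_sumset_mul_le A B C k hβpos hβ
  have hpow := le_exp_mul_div_pow_of_prod_eq hh hβpos hβ
  have hNpos : (0 : ℝ) < ((iterSum B h).card : ℝ) := by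
    have hprod : 0 < ∏ r ∈ Finset.range h, (β + r) := Finset.prod_pos fun r _ => by positivity
    rw [hβ] at hprod
    exact pos_of_mul_pos_right hprod hfact.le
  set N : ℝ := ((iterSum B h).card : ℝ)
  have hroot : N ^ (1 / (h : ℝ)) ≤ Real.exp 1 * (β + h) / h := by
    rw [one_div]
    calc N ^ ((h : ℝ)⁻¹) ≤ ((Real.exp 1 * (β + h) / h) ^ h) ^ ((h : ℝ)⁻¹) := by gcongr
      _ = _ := Real.pow_rpow_inv_natCast (by positivity) hh.ne'
  have hsplit : N ^ (1 - 1 / (h : ℝ)) * N ^ (1 / (h : ℝ)) = N := by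
    rw [← Real.rpow_add hNpos, sub_add_cancel, Real.rpow_one]
  refine le_of_mul_le_mul_right (hmain.trans ?_) hβpos
  calc (((A + B) \ C).card : ℝ) * N
      = (((A + B) \ C).card : ℝ) * (N ^ (1 - 1 / (h : ℝ)) * N ^ (1 / (h : ℝ))) := by
        rw [hsplit]
    _ ≤ (((A + B) \ C).card : ℝ) *
        (N ^ (1 - 1 / (h : ℝ)) * (Real.exp 1 * (β + h) / h)) := by gcongr
    _ = _ := by field_simp
end

section
/- Let $h$ be a positive integer, $A$, $B$ finite non-empty sets in a commutative group with $|A| = m$ and $|A+B| = n$, and let $t$ be a real with $0 \le t < m$. Then there exists a non-empty subset $X \subseteq A$ with $|X| > t$ such that $|X + hB| \le (|X| - t) \left(\frac{n}{m - t}\right)^h$. -/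
open Pointwise

/-- Petridis' inequality with a defect `t`: if `X` minimises `|Z + B| / (|Z| - t)` among its
subsets, then `|C + X + B| ≤ K (|C + X| - t)` for every nonempty `C`, where `K` is the minimum. -/
theorem card_add_add_le_mul_card_add_sub {G : Type*} [AddCommGroup G] [DecidableEq G]
    {X B C : Finset G} {K t : ℝ} (hX : ((X + B).card : ℝ) ≤ K * (X.card - t))
    (hZ : ∀ Z ⊆ X, K * (Z.card - t) ≤ ((Z + B).card : ℝ)) (hC : C.Nonempty) :
    ((C + X + B).card : ℝ) ≤ K * ((C + X).card - t) := by
  induction hC using Finset.Nonempty.cons_induction with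
  | singleton c => simpa [add_assoc, Finset.card_singleton_add] using hX
  | cons c C hc hC ih =>
    rw [Finset.cons_eq_insert, Finset.insert_eq, Finset.union_comm, Finset.union_add,
      Finset.union_add]
    set Z := X ∩ ({-c} + (C + X)) with hZdef
    have hZX : Z ⊆ X := Finset.inter_subset_left
    have hcZ : {c} + Z = (C + X) ∩ ({c} + X) := by
      rw [hZdef, Finset.singleton_add_inter, ← add_assoc ({c} : Finset G), Finset.singleton_add_singleton,
        add_neg_cancel, Finset.singleton_zero, zero_add, Finset.inter_comm]
    have hcard : ((C + X ∪ ({c} + X)).card : ℝ) + Z.card = (C + X).card + X.card := by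
      have := Finset.card_union_add_card_inter (C + X) ({c} + X)
      rw [← hcZ, Finset.card_singleton_add, Finset.card_singleton_add] at this
      exact_mod_cast this
    have hsub : {c} + Z + B ⊆ (C + X + B) ∩ ({c} + X + B) := by
      rw [hcZ]
      exact Finset.inter_add_subset
    have hcardB : ((C + X + B ∪ ({c} + X + B)).card : ℝ) + (Z + B).card ≤
        (C + X + B).card + (X + B).card := by
      have hunion := Finset.card_union_add_card_inter (C + X + B) ({c} + X + B)
      have hinter := Finset.card_le_card hsub
      rw [add_assoc, Finset.card_singleton_add] at hinter
      rw [add_assoc {c} X, Finset.card_singleton_add, ← add_assoc] at hunion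
      exact_mod_cast (by omega : _ ≤ _)
    have hmin := hZ Z hZX
    linear_combination hcardB + hmin + ih + hX - K * hcard

theorem iterSum_nonempty {G : Type*} [AddCommGroup G] [DecidableEq G] {B : Finset G}
    (hB : B.Nonempty) (k : ℕ) : (iterSum B k).Nonempty := by
  induction k with
  | zero => exact Finset.singleton_nonempty 0
  | succ k ih => exact ih.add hB

/-- Plünnecke's inequality for a large subset: if `|A| = m`, `|A+B| = n` and `0 ≤ t < m`,
then some `X ⊆ A` with `|X| > t` satisfies `|X + hB| ≤ (|X| - t) (n/(m-t))^h`. -/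
theorem stmt_14 {G : Type*} [AddCommGroup G] [DecidableEq G]
    (h : ℕ) (hh : 0 < h)
    (A B : Finset G) (hA : A.Nonempty) (hB : B.Nonempty)
    (m n : ℕ) (hm : A.card = m) (hn : (A + B).card = n)
    (t : ℝ) (ht0 : 0 ≤ t) (htm : t < m) :
    ∃ X ⊆ A, X.Nonempty ∧ t < (X.card : ℝ) ∧
      ((X + iterSum B h).card : ℝ) ≤
        ((X.card : ℝ) - t) * ((n : ℝ) / ((m : ℝ) - t)) ^ h := by
  subst hm hn
  have hAmem : A ∈ A.powerset.filter fun Z ↦ t < (Z.card : ℝ) := by simpa using htm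
  obtain ⟨X, hXmem, hXmin⟩ := Finset.exists_min_image _
    (fun Z ↦ ((Z + B).card : ℝ) / (Z.card - t)) ⟨A, hAmem⟩
  obtain ⟨hXA, htX⟩ : X ⊆ A ∧ t < (X.card : ℝ) := by simpa using hXmem
  set K : ℝ := ((X + B).card : ℝ) / (X.card - t) with hK
  have hXpos : 0 < (X.card : ℝ) - t := sub_pos.2 htX
  have hK0 : 0 ≤ K := by positivity
  have hXB : ((X + B).card : ℝ) = K * (X.card - t) := (div_mul_cancel₀ _ hXpos.ne').symm
  have hZ : ∀ Z ⊆ X, K * (Z.card - t) ≤ ((Z + B).card : ℝ) := by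
    intro Z hZX
    rcases lt_or_ge t (Z.card : ℝ) with htZ | htZ
    · exact (le_div_iff₀ (sub_pos.2 htZ)).1
        (hXmin Z (by simpa using And.intro (hZX.trans hXA) htZ))
    · exact (mul_nonpos_of_nonneg_of_nonpos hK0 (sub_nonpos.2 htZ)).trans (Nat.cast_nonneg _)
  have hpow : ∀ k, ((X + iterSum B (k + 1)).card : ℝ) ≤ (X.card - t) * K ^ (k + 1) := by
    intro k
    induction k with
    | zero =>
      simp only [iterSum, Finset.singleton_zero, zero_add, pow_one]
      rw [hXB, mul_comm]
    | succ k ih =>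
      have hstep := card_add_add_le_mul_card_add_sub hXB.le hZ (iterSum_nonempty hB (k + 1))
      rw [add_comm _ X, add_assoc] at hstep
      calc ((X + iterSum B (k + 1 + 1)).card : ℝ)
          ≤ K * ((X + iterSum B (k + 1)).card - t) := hstep
        _ ≤ K * ((X.card - t) * K ^ (k + 1)) :=
          mul_le_mul_of_nonneg_left (by linarith) hK0
        _ = (X.card - t) * K ^ (k + 1 + 1) := by ring
  obtain ⟨k, rfl⟩ := Nat.exists_eq_succ_of_ne_zero hh.ne'
  refine ⟨X, hXA, Finset.card_pos.1 (by exact_mod_cast ht0.trans_lt htX), htX,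
    (hpow k).trans ?_⟩
  exact mul_le_mul_of_nonneg_left (pow_le_pow_left₀ hK0 (hXmin A hAmem) _) hXpos.le
end
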